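/- arXiv:1603.02839 — 3 statements merged into one kernel-verified Lean document; each statement's English description precedes it below -/
import Mathlib

section
/- Let C, D, n, κ > 0 be real numbers with n·C > D. Define V(m) = D/m + C·e^{−n/m} for m > 0, and set m* = max{κ, n/(log n + log(C/D))}. Then for every m ≥ κ, V(m) ≥ V(m*). -/
/-- The convex function `x ↦ a x + C e^{-x}` lies above its value at `y` wherever its slope
at `y` has the same sign as `x - y`. -/
lemma linear_add_exp_neg_le {a C x y : ℝ} (hC : 0 ≤ C)
    (h : 0 ≤ (a - C * Real.exp (-y)) * (x - y)) :
    a * y + C * Real.exp (-y) ≤ a * x + C * Real.exp (-x) := by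
  have hexp : Real.exp (-y) * (y - x + 1) ≤ Real.exp (-x) := by
    calc Real.exp (-y) * (y - x + 1) ≤ Real.exp (-y) * Real.exp (y - x) := by
          gcongr
          exact Real.add_one_le_exp _
      _ = Real.exp (-x) := by rw [← Real.exp_add]; ring_nf
  linarith [mul_le_mul_of_nonneg_left hexp hC]


/-- Proposition 2 (optimal fixed sample size): `V(m) = D/m + C·e^{-n/m}` is minimized
over `m ≥ κ` at `m* = max {κ, n/(log n + log(C/D))}`. -/
theorem optimal_sample_size (C D n κ : ℝ) (hC : 0 < C) (hD : 0 < D) (hn : 0 < n)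
    (hκ : 0 < κ) (h : D < n * C) :
    ∀ m : ℝ, κ ≤ m →
      D / max κ (n / (Real.log n + Real.log (C / D)))
          + C * Real.exp (-(n / max κ (n / (Real.log n + Real.log (C / D)))))
        ≤ D / m + C * Real.exp (-(n / m)) := by
  intro m hm
  have hm0 : 0 < m := hκ.trans_le hm
  set L := Real.log n + Real.log (C / D) with hL_def
  have hL : L = Real.log (n * C / D) := by
    rw [hL_def, ← Real.log_mul hn.ne' (by positivity), mul_div_assoc]
  have hL0 : 0 < L := hL ▸ Real.log_pos ((one_lt_div hD).2 h)
  have hexpL : C * Real.exp (-L) = D / n := by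
    rw [hL, Real.exp_neg, Real.exp_log (by positivity)]
    field_simp
  have hscale (t : ℝ) : D / t = D / n * (n / t) := by field_simp
  rw [hscale, hscale m]
  apply linear_add_exp_neg_le hC.le
  rcases le_total κ (n / L) with hκL | hLκ
  · rw [max_eq_right hκL, div_div_cancel₀ hn.ne', hexpL]
    simp
  · rw [max_eq_left hLκ]
    have hslope : D / n ≤ C * Real.exp (-(n / κ)) := by
      rw [← hexpL]
      gcongr
      exact (div_le_comm₀ hL0 hκ).1 hLκ
    have hnm : n / m ≤ n / κ := by gcongr
    exact mul_nonneg_of_nonpos_of_nonpos (sub_nonpos.2 hslope) (sub_nonpos.2 hnm)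
end

section
/- Let D > 0, ξ ≥ 0, κ ≥ 1 be reals, let α be a real with 0 < α ≤ 1, and let n₀ be a positive integer. Suppose u : ℕ → ℝ satisfies u(n₀) ≤ D·n₀^{−α} + (ξ/2)·(κ/n₀)² and, for every n ≥ n₀, u(n+1) ≤ (n/(n+1))² · ( u(n) + D·n^{−α}/(n+1) ). Then for every n ≥ n₀, u(n) ≤ D·n^{−α} + (ξ/2)·(κ/n)². -/
/-- For `α ≤ 1`, the ratio `(x + 1)^{-α} / x^{-α}` is at least `x / (x + 1)`. -/
lemma div_add_one_mul_rpow_neg_le {α x : ℝ} (hα : α ≤ 1) (hx : 0 < x) :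
    x / (x + 1) * x ^ (-α) ≤ (x + 1) ^ (-α) := by
  have key : ∀ y : ℝ, 0 < y → y * y ^ (-α) = y ^ (1 - α) := fun y hy => by
    rw [sub_eq_add_neg, Real.rpow_add hy, Real.rpow_one]
  have hmono : x ^ (1 - α) ≤ (x + 1) ^ (1 - α) :=
    Real.rpow_le_rpow hx.le (by linarith) (by linarith)
  rw [← key x hx, ← key (x + 1) (by linarith)] at hmono
  rw [div_mul_eq_mul_div, div_le_iff₀ (by linarith)]
  linarith

/-- Lemma 4 (two-pass lemma) in recurrence form: the Linear schedule of dynaSAGA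
satisfies `u(n) ≤ D·n^{-α} + (ξ/2)(κ/n)²` for all `n ≥ n₀`. -/
theorem two_pass_lemma (D ξ κ : ℝ) (hD : 0 < D) (hξ : 0 ≤ ξ) (hκ : 1 ≤ κ)
    (α : ℝ) (hα0 : 0 < α) (hα1 : α ≤ 1)
    (n₀ : ℕ) (hn₀ : 0 < n₀) (u : ℕ → ℝ)
    (hbase : u n₀ ≤ D * (n₀ : ℝ) ^ (-α) + ξ / 2 * (κ / (n₀ : ℝ)) ^ 2)
    (hstep : ∀ n : ℕ, n₀ ≤ n →
      u (n + 1) ≤ ((n : ℝ) / ((n : ℝ) + 1)) ^ 2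
        * (u n + D * (n : ℝ) ^ (-α) / ((n : ℝ) + 1))) :
    ∀ n : ℕ, n₀ ≤ n → u n ≤ D * (n : ℝ) ^ (-α) + ξ / 2 * (κ / (n : ℝ)) ^ 2 := by
  intro n hn
  induction n, hn using Nat.le_induction with
  | base => exact hbase
  | succ n hn ih =>
    have hx : (0 : ℝ) < n := by exact_mod_cast hn₀.trans_le hn
    have hstep_n := hstep n hn
    push_cast
    generalize (n : ℝ) = x at hx ih hstep_n ⊢
    have hx1 : 0 < x + 1 := by linarith
    have hfactor : (x / (x + 1)) ^ 2 * (1 + 1 / (x + 1)) ≤ x / (x + 1) := by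
      have hdiff : x / (x + 1) - (x / (x + 1)) ^ 2 * (1 + 1 / (x + 1)) = x / (x + 1) ^ 3 := by
        field_simp
        ring
      have : 0 ≤ x / (x + 1) ^ 3 := by positivity
      linarith
    calc u (n + 1)
        ≤ (x / (x + 1)) ^ 2 * (u n + D * x ^ (-α) / (x + 1)) := hstep_n
      _ ≤ (x / (x + 1)) ^ 2 *
            (D * x ^ (-α) + ξ / 2 * (κ / x) ^ 2 + D * x ^ (-α) / (x + 1)) := by
          gcongr
      _ = D * ((x / (x + 1)) ^ 2 * (1 + 1 / (x + 1)) * x ^ (-α))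
            + ξ / 2 * (κ / (x + 1)) ^ 2 := by
          field_simp
          ring
      _ ≤ D * (x / (x + 1) * x ^ (-α)) + ξ / 2 * (κ / (x + 1)) ^ 2 := by
          gcongr
      _ ≤ D * (x + 1) ^ (-α) + ξ / 2 * (κ / (x + 1)) ^ 2 := by
          gcongr
          exact div_add_one_mul_rpow_neg_le hα1 hx
end

section
/- Let D > 0, ξ ≥ 0, κ ≥ 1 be reals, let α be a real with 0 < α ≤ 1, and let n₀ be a positive integer. Suppose u : ℕ → ℝ satisfies u(n₀) ≤ D·n₀^{−α} + (ξ/2)·(κ/n₀)² and, for every n ≥ n₀, u(n+1) ≤ (n/(n+1))² · ( u(n) + D·n^{−α}/(n+1) ). Then for every n ≥ n₀: u(n) + (1/2)·D·n^{−α} ≤ 3·2^{α−1}·D·(2n)^{−α} + 2ξ·(κ/(2n))². -/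
/-- For `α ≤ 1`, the map `x ↦ x * x ^ (-α) = x ^ (1 - α)` is monotone on the positive reals. -/
theorem mul_rpow_neg_le_mul_rpow_neg {x y α : ℝ} (hx : 0 < x) (hxy : x ≤ y) (hα : α ≤ 1) :
    x * x ^ (-α) ≤ y * y ^ (-α) := by
  have h : ∀ z : ℝ, 0 < z → z * z ^ (-α) = z ^ (1 - α) := fun z hz => by
    rw [sub_eq_add_neg, Real.rpow_add hz, Real.rpow_one]
  rw [h x hx, h y (hx.trans_le hxy)]
  exact Real.rpow_le_rpow hx.le hxy (by linarith)

/-- The power `x ^ (-α)`, `α ≤ 1`, is preserved as an upper bound by the contraction step. -/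
theorem div_sq_mul_rpow_neg_le {x α : ℝ} (hx : 0 < x) (hα : α ≤ 1) :
    (x / (x + 1)) ^ 2 * (x ^ (-α) + x ^ (-α) / (x + 1)) ≤ (x + 1) ^ (-α) := by
  have hmono := mul_rpow_neg_le_mul_rpow_neg hx (by linarith : x ≤ x + 1) hα
  have hpos : 0 < (x + 1) ^ (-α) := by positivity
  calc (x / (x + 1)) ^ 2 * (x ^ (-α) + x ^ (-α) / (x + 1))
      = x * (x + 2) / (x + 1) ^ 3 * (x * x ^ (-α)) := by field_simp; ring
    _ ≤ x * (x + 2) / (x + 1) ^ 3 * ((x + 1) * (x + 1) ^ (-α)) := by gcongr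
    _ = x * (x + 2) / (x + 1) ^ 2 * (x + 1) ^ (-α) := by field_simp
    _ ≤ 1 * (x + 1) ^ (-α) := by
        gcongr
        rw [div_le_one (by positivity)]
        nlinarith
    _ = (x + 1) ^ (-α) := one_mul _

/-- Corollary 5 (one-pass bound) in recurrence form:
`u(n) + (1/2) D n^{-α} ≤ 3·2^{α-1}·D·(2n)^{-α} + 2ξ(κ/(2n))²` for `n ≥ n₀`. -/
theorem one_pass_bound (D ξ κ : ℝ) (hD : 0 < D) (hξ : 0 ≤ ξ) (hκ : 1 ≤ κ)
    (α : ℝ) (hα0 : 0 < α) (hα1 : α ≤ 1)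
    (n₀ : ℕ) (hn₀ : 0 < n₀) (u : ℕ → ℝ)
    (hbase : u n₀ ≤ D * (n₀ : ℝ) ^ (-α) + ξ / 2 * (κ / (n₀ : ℝ)) ^ 2)
    (hstep : ∀ n : ℕ, n₀ ≤ n →
      u (n + 1) ≤ ((n : ℝ) / ((n : ℝ) + 1)) ^ 2
        * (u n + D * (n : ℝ) ^ (-α) / ((n : ℝ) + 1))) :
    ∀ n : ℕ, n₀ ≤ n →
      u n + 1 / 2 * D * (n : ℝ) ^ (-α)
        ≤ 3 * (2 : ℝ) ^ (α - 1) * D * (2 * (n : ℝ)) ^ (-α)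
            + 2 * ξ * (κ / (2 * (n : ℝ))) ^ 2 := by
  intro n hn
  have hbound : u n ≤ D * (n : ℝ) ^ (-α) + ξ / 2 * (κ / (n : ℝ)) ^ 2 := by
    induction n, hn using Nat.le_induction with
    | base => exact hbase
    | succ n hn ih =>
      have hpos : (0 : ℝ) < n := by exact_mod_cast hn₀.trans_le hn
      push_cast
      calc u (n + 1)
          ≤ ((n : ℝ) / (n + 1)) ^ 2 * (u n + D * (n : ℝ) ^ (-α) / (n + 1)) := hstep n hn
        _ ≤ ((n : ℝ) / (n + 1)) ^ 2 * ((D * (n : ℝ) ^ (-α) + ξ / 2 * (κ / n) ^ 2)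
              + D * (n : ℝ) ^ (-α) / (n + 1)) := by gcongr
        _ = D * (((n : ℝ) / (n + 1)) ^ 2 * ((n : ℝ) ^ (-α) + (n : ℝ) ^ (-α) / (n + 1)))
              + ξ / 2 * (κ / (n + 1)) ^ 2 := by field_simp; ring
        _ ≤ D * ((n : ℝ) + 1) ^ (-α) + ξ / 2 * (κ / (n + 1)) ^ 2 := by
            gcongr
            exact div_sq_mul_rpow_neg_le hpos hα1
  have htwo : (2 : ℝ) ^ (α - 1) * (2 : ℝ) ^ (-α) = 1 / 2 := by
    rw [← Real.rpow_add two_pos, show α - 1 + -α = -1 by ring, Real.rpow_neg_one, one_div]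
  have hrhs : 3 * (2 : ℝ) ^ (α - 1) * D * (2 * (n : ℝ)) ^ (-α) + 2 * ξ * (κ / (2 * (n : ℝ))) ^ 2
      = 3 / 2 * D * (n : ℝ) ^ (-α) + ξ / 2 * (κ / n) ^ 2 := by
    rw [Real.mul_rpow two_pos.le n.cast_nonneg, mul_comm 2 (n : ℝ), ← div_div]
    linear_combination 3 * D * (n : ℝ) ^ (-α) * htwo
  linarith
end
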